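/- The universal theory of the class of finite groups is undecidable: there is no computable function deciding, for a given universal sentence in the language of groups, whether it holds in every finite group. -/

import Mathlib

open FirstOrder

/-- The first-order language of groups: one binary function symbol (multiplication),
one unary function symbol (inversion), and one constant symbol (identity). -/
def grpLang : FirstOrder.Language where
  Functions := fun n =>
    match n with
    | 0 => Unit
    | 1 => Unit
    | 2 => Unit
    | _ + 3 => Empty
  Relations := fun _ => Empty

/-- Every group is naturally a structure for the language of groups. -/
instance grpStructure (G : Type*) [Group G] : grpLang.Structure G where
  funMap := fun {n} f x =>
    match n, f, x with
    | 0, _, _ => (1 : G)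
    | 1, _, x => (x 0)⁻¹
    | 2, _, x => x 0 * x 1
    | _ + 3, f, _ => f.elim
  RelMap := fun {_} r _ => r.elim

/-- A universal sentence is one of the form `∀ x₁ … ∀ xₖ, Φ` with `Φ` quantifier-free. -/
def IsUniversalSentence (φ : grpLang.Sentence) : Prop :=
  ∃ (k : ℕ) (ψ : grpLang.BoundedFormula Empty k), ψ.IsQF ∧ φ = ψ.alls

/-- A fixed effective encoding of the symbols of `grpLang`. -/
instance grpFunEncodable (n : ℕ) : Encodable (grpLang.Functions n) :=
  match n with
  | 0 => inferInstanceAs (Encodable Unit)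
  | 1 => inferInstanceAs (Encodable Unit)
  | 2 => inferInstanceAs (Encodable Unit)
  | _ + 3 => inferInstanceAs (Encodable Empty)

instance grpRelEncodable (n : ℕ) : Encodable (grpLang.Relations n) :=
  inferInstanceAs (Encodable Empty)

/-- The fixed effective encoding of first-order formulas of `grpLang` (via Mathlib's
list encoding of bounded formulas). -/
instance grpSigmaBFEncodable : Encodable (Σ n, grpLang.BoundedFormula Empty n) :=
  Encodable.ofLeftInjection
    (fun φ => φ.2.listEncode)
    (fun l => (FirstOrder.Language.BoundedFormula.listDecode l)[0]?)
    (fun φ => FirstOrder.Language.BoundedFormula.encoding.decode_encode φ)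

/-- The fixed effective encoding of `grpLang`-sentences as natural numbers. -/
instance grpSentenceEncodable : Encodable grpLang.Sentence :=
  Encodable.ofLeftInjection
    (fun φ => (⟨0, φ⟩ : Σ n, grpLang.BoundedFormula Empty n))
    (fun ψ => match ψ with | ⟨0, φ⟩ => some φ | _ => none)
    (fun _ => rfl)


/-! ### Part 1: words as iterated commutators -/

/-- Some index different from both arguments. -/
def thirdIx (i j : Fin 5) : Fin 5 :=
  if i ≠ 0 ∧ j ≠ 0 then 0 else if i ≠ 1 ∧ j ≠ 1 then 1 else 2

theorem thirdIx_ne (i j : Fin 5) : thirdIx i j ≠ i ∧ thirdIx i j ≠ j := by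
  revert i j; decide

theorem exists_ix (i j k l : Fin 5) : ∃ p, p ≠ i ∧ p ≠ j ∧ p ≠ k ∧ p ≠ l := by
  revert i j k l; decide

/-- The value of a word `w` at the root `(i, j)`: an iterated commutator. -/
def wordVal {α S : Type*} (cm : α → α → α) (e : α) (x : Fin 5 → Fin 5 → S → α) :
    Fin 5 → Fin 5 → List S → α
  | _, _, [] => e
  | i, j, [c] => x i j c
  | i, j, c :: d :: w => cm (x i (thirdIx i j) c) (wordVal cm e x (thirdIx i j) j (d :: w))

open scoped commutatorElement

section GroupPart

variable {G S : Type*} [Group G]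

theorem hall_witt_exact {a b c : G} (h1 : Commute a c)
    (h2 : Commute ⁅b, c⁆ ⁅a, b⁆) (h3 : Commute ⁅b, c⁆ c) :
    ⁅a, ⁅b, c⁆⁆ = ⁅⁅a, b⁆, c⁆ := by
  have e1 : a * b * a⁻¹ = ⁅a, b⁆ * b := by simp [commutatorElement_def]
  have e2 : b * c * b⁻¹ = ⁅b, c⁆ * c := by simp [commutatorElement_def]
  have e3 : a * c * a⁻¹ = c := by rw [h1.eq]; simp
  have e4 : a * ⁅b, c⁆ * a⁻¹ = ⁅a, b⁆ * ⁅b, c⁆ * (c * ⁅a, b⁆⁻¹ * c⁻¹) := by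
    have : a * ⁅b, c⁆ * a⁻¹
        = (a * b * a⁻¹) * (a * c * a⁻¹) * (a * b * a⁻¹)⁻¹ * (a * c * a⁻¹)⁻¹ := by
      rw [commutatorElement_def b c]; group
    rw [this, e3, e1]
    have : ⁅a, b⁆ * b * c * (⁅a, b⁆ * b)⁻¹ * c⁻¹ = ⁅a, b⁆ * (b * c * b⁻¹) * ⁅a, b⁆⁻¹ * c⁻¹ := by
      group
    rw [this, e2]; group
  have h5 : Commute ⁅b, c⁆ (c * ⁅a, b⁆⁻¹ * c⁻¹) :=
    (h3.mul_right h2.inv_right).mul_right h3.inv_right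
  rw [commutatorElement_def a ⁅b, c⁆, e4, mul_assoc ⁅a, b⁆, h5.eq, commutatorElement_def ⁅a, b⁆ c]
  group

theorem commute_commutator {a b c : G} (h1 : Commute a c) (h2 : Commute b c) :
    Commute ⁅a, b⁆ c := by
  rw [commutatorElement_def]
  exact ((h1.mul_left h2).mul_left h1.inv_left).mul_left h2.inv_left

/-- The value of a word in a group. -/
abbrev gVal (x : Fin 5 → Fin 5 → S → G) : Fin 5 → Fin 5 → List S → G :=
  wordVal (fun a b => ⁅a, b⁆) 1 x

/-- Commutation relations. -/
def RelComm (x : Fin 5 → Fin 5 → S → G) : Prop :=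
  ∀ i j k l c d, i ≠ j → k ≠ l → j ≠ k → i ≠ l → ⁅x i j c, x k l d⁆ = 1

/-- Independence of the middle index. -/
def RelMid (x : Fin 5 → Fin 5 → S → G) : Prop :=
  ∀ i j p q c d, i ≠ j → p ≠ i → p ≠ j → q ≠ i → q ≠ j →
    ⁅x i p c, x p j d⁆ = ⁅x i q c, x q j d⁆

theorem gVal_cons (x : Fin 5 → Fin 5 → S → G) (i j : Fin 5) (c : S) (w : List S) (hw : w ≠ []) :
    gVal x i j (c :: w) = ⁅gVal x i (thirdIx i j) [c], gVal x (thirdIx i j) j w⁆ := by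
  cases w with
  | nil => exact absurd rfl hw
  | cons d w => rfl

/-- Splitting property for words of length `n`. -/
def SplitAt (x : Fin 5 → Fin 5 → S → G) (n : ℕ) : Prop :=
  ∀ u v : List S, u ≠ [] → v ≠ [] → u.length + v.length = n → ∀ i j p, i ≠ j → p ≠ i → p ≠ j →
    gVal x i j (u ++ v) = ⁅gVal x i p u, gVal x p j v⁆

/-- Commutation property for a pair of words. -/
def CommAt (x : Fin 5 → Fin 5 → S → G) (u v : List S) : Prop :=
  ∀ i j k l, i ≠ j → k ≠ l → j ≠ k → i ≠ l → Commute (gVal x i j u) (gVal x k l v)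

theorem comm_of_split {x : Fin 5 → Fin 5 → S → G} (h1 : RelComm x) (n : ℕ)
    (hs : ∀ m ≤ n, SplitAt x m) :
    ∀ N : ℕ, ∀ u v : List S, u.length ≤ n → v.length ≤ n → u.length + v.length ≤ N →
      CommAt x u v := by
  intro N
  induction N with
  | zero =>
    intro u v _ _ h i j k l _ _ _ _
    have : u = [] := List.length_eq_zero_iff.1 (by omega)
    subst this
    exact Commute.one_left _
  | succ N ih =>
    intro u v hu hv hN i j k l hij hkl hjk hil
    obtain ⟨p, hpi, hpj, hpk, hpl⟩ := exists_ix i j k l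
    match u, v, hu, hv, hN with
    | [], _, _, _, _ => exact Commute.one_left _
    | _, [], _, _, _ => exact Commute.one_right _
    | [c], [d], _, _, _ => exact commutatorElement_eq_one_iff_commute.1 (h1 i j k l c d hij hkl hjk hil)
    | c :: c' :: u, v, hu, hv, hN =>
      have := hs _ hu [c] (c' :: u) (by simp) (by simp) (by simp; omega) i j p hij hpi hpj
      simp only [List.singleton_append] at this
      rw [this]
      simp only [List.length_cons] at hu hv hN
      refine commute_commutator
        (ih [c] v ?_ hv ?_ i p k l hpi.symm hkl hpk hil)
        (ih (c' :: u) v ?_ hv ?_ p j k l hpj hkl hjk hpl) <;> simp only [List.length_cons, List.length_nil] <;> omega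
    | u, c :: c' :: v, hu, hv, hN =>
      have := hs _ hv [c] (c' :: v) (by simp) (by simp) (by simp; omega) k l p hkl hpk hpl
      simp only [List.singleton_append] at this
      rw [this]
      simp only [List.length_cons] at hu hv hN
      refine (commute_commutator
        (ih u [c] hu ?_ ?_ i j k p hij hpk.symm hjk hpi.symm).symm
        (ih u (c' :: v) hu ?_ ?_ i j p l hij hpl hpj.symm hil).symm).symm <;> simp only [List.length_cons, List.length_nil] <;> omega

theorem split_step {x : Fin 5 → Fin 5 → S → G} (n : ℕ)
    (hs : ∀ m < n, SplitAt x m)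
    (hc : ∀ u v : List S, u.length < n → v.length < n → CommAt x u v)
    (u v : List S) (d : S) (hu : u ≠ []) (hv : v ≠ []) (hn : u.length + v.length + 1 = n)
    (i j p r : Fin 5) (hij : i ≠ j) (hpi : p ≠ i) (hpj : p ≠ j) (hri : r ≠ i) (hrj : r ≠ j)
    (hrp : r ≠ p) :
    ⁅gVal x i p u, gVal x p j (d :: v)⁆ = ⁅gVal x i r (u ++ [d]), gVal x r j v⁆ := by
  have lu := List.length_pos_iff.2 hu
  have lv := List.length_pos_iff.2 hv
  have e1 := hs (v.length + 1) (by omega) [d] v (by simp) hv (by simp; omega) p j r hpj hrp hrj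
  have e2 := hs (u.length + 1) (by omega) u [d] hu (by simp) (by simp) i r p hri.symm hpi hrp.symm
  simp only [List.singleton_append] at e1
  rw [e2, e1]
  refine hall_witt_exact ?_ ?_ ?_
  · exact hc u v (by omega) (by omega) i p r j hpi.symm hrj hrp.symm hij
  · rw [← e1, ← e2]
    exact hc _ _ (by simp; omega) (by simp; omega) p j i r hpj hri.symm hij.symm hrp.symm
  · rw [← e1]
    exact hc _ _ (by simp; omega) (by omega) p j r j hpj hrj hrj.symm hpj

theorem split_all {x : Fin 5 → Fin 5 → S → G} (h1 : RelComm x) (h2 : RelMid x) :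
    ∀ n, SplitAt x n := by
  intro n
  induction n using Nat.strong_induction_on with
  | _ n hs =>
  have hc : ∀ u v : List S, u.length < n → v.length < n → CommAt x u v := by
    intro u v hu hv
    exact comm_of_split h1 (n - 1) (fun m hm => hs m (by omega)) _ u v (by omega) (by omega) le_rfl
  -- the key claim
  have key : ∀ k : ℕ, ∀ u v : List S, u.length = k + 1 → v ≠ [] → u.length + v.length = n →
      ∀ i j p q, i ≠ j → p ≠ i → p ≠ j → q ≠ i → q ≠ j → ∀ c w, u ++ v = c :: w →
      ⁅gVal x i p u, gVal x p j v⁆ = ⁅gVal x i q [c], gVal x q j w⁆ := by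
    intro k
    induction k with
    | zero =>
      intro u v hu hv hn i j p q hij hpi hpj hqi hqj c w hcw
      obtain ⟨a, rfl⟩ := List.length_eq_one_iff.1 hu
      simp only [List.singleton_append, List.cons.injEq] at hcw
      obtain ⟨rfl, rfl⟩ := hcw
      match v, hv, hn with
      | [d], _, _ => exact h2 i j p q a d hij hpi hpj hqi hqj
      | d :: d' :: v, _, hn =>
        obtain ⟨r, hri, hrj, hrp, hrq⟩ := exists_ix i j p q
        rw [split_step n hs hc [a] (d' :: v) d (by simp) (by simp) (by simp at hn ⊢; omega) i j p r
            hij hpi hpj hri hrj hrp,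
          split_step n hs hc [a] (d' :: v) d (by simp) (by simp) (by simp at hn ⊢; omega) i j q r
            hij hqi hqj hri hrj hrq]
    | succ k ih =>
      intro u v hu hv hn i j p q hij hpi hpj hqi hqj c w hcw
      obtain ⟨u', d, rfl⟩ : ∃ u' d, u = u' ++ [d] :=
        ⟨u.dropLast, u.getLast (by rintro rfl; simp at hu), (List.dropLast_append_getLast _).symm⟩
      simp only [List.length_append, List.length_singleton] at hu hn
      obtain ⟨r, hri, hrj, hrp, -⟩ := exists_ix i j p p
      rw [← split_step n hs hc u' v d (by rintro rfl; simp at hu) hv (by omega) i j r p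
        hij hri hrj hpi hpj hrp.symm]
      exact ih u' (d :: v) (by omega) (by simp) (by simp; omega) i j r q hij hri hrj hqi hqj c w
        (by simpa using hcw)
  intro u v hu hv hn i j p hij hpi hpj
  obtain ⟨c, u, rfl⟩ := List.exists_cons_of_ne_nil hu
  rw [key u.length (c :: u) v rfl hv hn i j p (thirdIx i j) hij hpi hpj
    (thirdIx_ne i j).1 (thirdIx_ne i j).2 c (u ++ v) rfl]
  exact gVal_cons x i j c (u ++ v) (by simp [hv])

theorem gVal_append {x : Fin 5 → Fin 5 → S → G} (h1 : RelComm x) (h2 : RelMid x)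
    (u v : List S) (hu : u ≠ []) (hv : v ≠ []) (i j p : Fin 5) (hij : i ≠ j) (hpi : p ≠ i)
    (hpj : p ≠ j) : gVal x i j (u ++ v) = ⁅gVal x i p u, gVal x p j v⁆ :=
  split_all h1 h2 _ u v hu hv rfl i j p hij hpi hpj

theorem gVal_context {x : Fin 5 → Fin 5 → S → G} (h1 : RelComm x) (h2 : RelMid x)
    (u v : List S) (hu : u ≠ []) (hv : v ≠ [])
    (h : ∀ i j, i ≠ j → gVal x i j u = gVal x i j v) (p s : List S) :
    ∀ i j, i ≠ j → gVal x i j (p ++ u ++ s) = gVal x i j (p ++ v ++ s) := by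
  have hp : ∀ i j, i ≠ j → gVal x i j (p ++ u) = gVal x i j (p ++ v) := by
    intro i j hij
    rcases eq_or_ne p [] with rfl | hp
    · exact h i j hij
    · obtain ⟨r, hri, hrj, -, -⟩ := exists_ix i j i j
      rw [gVal_append h1 h2 p u hp hu i j r hij hri hrj,
        gVal_append h1 h2 p v hp hv i j r hij hri hrj, h r j hrj]
  intro i j hij
  rcases eq_or_ne s [] with rfl | hs
  · simpa using hp i j hij
  · obtain ⟨r, hri, hrj, -, -⟩ := exists_ix i j i j
    rw [gVal_append h1 h2 (p ++ u) s (by simp [hu]) hs i j r hij hri hrj,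
      gVal_append h1 h2 (p ++ v) s (by simp [hv]) hs i j r hij hri hrj, hp i r hri.symm]

theorem gVal_zero_context {x : Fin 5 → Fin 5 → S → G} (h1 : RelComm x) (h2 : RelMid x)
    (u : List S) (hu : u ≠ [])
    (h : ∀ i j, i ≠ j → gVal x i j u = 1) (p s : List S) :
    ∀ i j, i ≠ j → gVal x i j (p ++ u ++ s) = 1 := by
  have hp : ∀ i j, i ≠ j → gVal x i j (p ++ u) = 1 := by
    intro i j hij
    rcases eq_or_ne p [] with rfl | hp
    · exact h i j hij
    · obtain ⟨r, hri, hrj, -, -⟩ := exists_ix i j i j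
      rw [gVal_append h1 h2 p u hp hu i j r hij hri hrj, h r j hrj, commutatorElement_one_right]
  intro i j hij
  rcases eq_or_ne s [] with rfl | hs
  · simpa using hp i j hij
  · obtain ⟨r, hri, hrj, -, -⟩ := exists_ix i j i j
    rw [gVal_append h1 h2 (p ++ u) s (by simp [hu]) hs i j r hij hri hrj, hp i r hri.symm,
      commutatorElement_one_left]

end GroupPart

/-! ### Part 2: finite models from finite invariant languages -/

section ModelPart

variable {R : Type} [Ring R]

theorem single_mul_ne {i j k l : Fin 5} (h : j ≠ k) (r s : R) :
    Matrix.single i j r * Matrix.single k l s = 0 := by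
  simp [h]

/-- Elementary matrices as units. -/
def elU (i j : Fin 5) (r : R) : (Matrix (Fin 5) (Fin 5) R)ˣ :=
  if h : i ≠ j then
    { val := 1 + Matrix.single i j r
      inv := 1 - Matrix.single i j r
      val_inv := by simp [add_mul, mul_sub, single_mul_ne h.symm]
      inv_val := by simp [sub_mul, mul_add, single_mul_ne h.symm] }
  else 1

theorem elU_val {i j : Fin 5} (h : i ≠ j) (r : R) :
    (elU i j r : Matrix (Fin 5) (Fin 5) R) = 1 + Matrix.single i j r := by
  simp [elU, h]

theorem elU_comm {i j k l : Fin 5} (r s : R) (hij : i ≠ j) (hkl : k ≠ l) (hjk : j ≠ k)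
    (hil : i ≠ l) : ⁅elU i j r, elU k l s⁆ = 1 := by
  rw [commutatorElement_eq_one_iff_mul_comm]
  ext1
  simp only [Units.val_mul, elU_val hij, elU_val hkl, add_mul, mul_add, one_mul, mul_one,
    single_mul_ne hjk, single_mul_ne hil.symm]
  abel

theorem elU_mul {i j p : Fin 5} (r s : R) (hij : i ≠ j) (hpi : p ≠ i) (hpj : p ≠ j) :
    ⁅elU i p r, elU p j s⁆ = elU i j (r * s) := by
  rw [commutatorElement_def, mul_inv_eq_iff_eq_mul, mul_inv_eq_iff_eq_mul]
  ext1
  simp only [Units.val_mul, elU_val hij, elU_val hpi.symm, elU_val hpj, add_mul, mul_add, one_mul,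
    mul_one, single_mul_ne hij.symm,
    single_mul_ne hpj.symm, Matrix.single_mul_single_same, zero_mul]
  abel

theorem elU_ne_one {i j : Fin 5} (hij : i ≠ j) {r : R} (hr : r ≠ 0) : elU i j r ≠ 1 := by
  intro h
  have h1 := congrArg (fun u : (Matrix (Fin 5) (Fin 5) R)ˣ => (u : Matrix (Fin 5) (Fin 5) R) i j) h
  simp [elU_val hij, hij] at h1
  exact hr h1

theorem elU_zero {i j : Fin 5} (hij : i ≠ j) : elU i j (0 : R) = 1 := by
  ext1; simp [elU_val hij]

theorem gVal_elU {S : Type} (ρ : S → R) :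
    ∀ (w : List S), w ≠ [] → ∀ (i j : Fin 5), i ≠ j →
      gVal (fun i j c => elU i j (ρ c)) i j w = elU i j (w.map ρ).prod
  | [], h, _, _, _ => absurd rfl h
  | [c], _, i, j, _ => by simp [gVal, wordVal]
  | c :: d :: w, _, i, j, hij => by
    have h := thirdIx_ne i j
    have ih := gVal_elU ρ (d :: w) (by simp) (thirdIx i j) j h.2
    rw [gVal_cons _ _ _ _ _ (by simp), ih]
    simp only [gVal, wordVal]
    rw [elU_mul _ _ hij h.1 h.2]
    simp

variable {S : Type}

/-- The module of invariant functions supported on short words. -/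
def invMod (R : List S → List S → Prop) (Z : List S → Prop) (K : ℕ) :
    Submodule (ZMod 2) (List S → ZMod 2) where
  carrier := {f | (∀ w, K < w.length → f w = 0) ∧
    (∀ p s u v, R u v → f (p ++ u ++ s) = f (p ++ v ++ s)) ∧
    (∀ p s z, Z z → f (p ++ z ++ s) = 0)}
  add_mem' := by
    rintro f g ⟨f1, f2, f3⟩ ⟨g1, g2, g3⟩
    refine ⟨fun w hw => ?_, fun p s u v h => ?_, fun p s z h => ?_⟩
    · simp [f1 w hw, g1 w hw]
    · simp only [Pi.add_apply, f2 p s u v h, g2 p s u v h]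
    · simp only [Pi.add_apply, f3 p s z h, g3 p s z h, add_zero]
  zero_mem' := ⟨fun _ _ => rfl, fun _ _ _ _ _ => rfl, fun _ _ _ _ => rfl⟩
  smul_mem' := by
    rintro a f ⟨f1, f2, f3⟩
    refine ⟨fun w hw => ?_, fun p s u v h => ?_, fun p s z h => ?_⟩
    · simp [f1 w hw]
    · simp only [Pi.smul_apply, f2 p s u v h]
    · simp only [Pi.smul_apply, f3 p s z h, smul_zero]

theorem invMod_finite [Finite S] (R : List S → List S → Prop) (Z : List S → Prop) (K : ℕ) :
    Finite (invMod R Z K) := by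
  have : Finite {w : List S // w.length ≤ K} := (List.finite_length_le S K).to_subtype
  refine Finite.of_injective (β := {w : List S // w.length ≤ K} → ZMod 2)
    (fun f w => f.1 w.1) ?_
  intro f g h
  ext w
  by_cases hw : w.length ≤ K
  · exact congrFun h ⟨w, hw⟩
  · rw [f.2.1 w (by omega), g.2.1 w (by omega)]

/-- Translation operators. -/
def transOp (R : List S → List S → Prop) (Z : List S → Prop) (K : ℕ) (c : S) :
    Module.End (ZMod 2) (invMod R Z K) where
  toFun f := ⟨fun w => f.1 (w ++ [c]), by
    obtain ⟨f, f1, f2, f3⟩ := f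
    refine ⟨fun w hw => f1 _ (by simp; omega), fun p s u v h => ?_, fun p s z h => ?_⟩
    · simpa using f2 p (s ++ [c]) u v h
    · simpa using f3 p (s ++ [c]) z h⟩
  map_add' f g := rfl
  map_smul' a f := rfl

theorem transOp_prod (R : List S → List S → Prop) (Z : List S → Prop) (K : ℕ) (w : List S)
    (f : invMod R Z K) (v : List S) :
    (((w.map (transOp R Z K)).prod f : invMod R Z K) : List S → ZMod 2) v = f.1 (v ++ w) := by
  induction w generalizing v with
  | nil => simp
  | cons c w ih =>
    have := ih (v ++ [c])
    simp only [List.append_assoc, List.singleton_append] at this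
    rw [← this]; rfl

theorem exists_model [Finite S] (R : List S → List S → Prop) (Z : List S → Prop)
    (C : Set (List S)) (K : ℕ) (hK : ∀ w ∈ C, w.length ≤ K)
    (hR : ∀ p s u v, R u v → (p ++ u ++ s ∈ C ↔ p ++ v ++ s ∈ C))
    (hZ : ∀ p s z, Z z → p ++ z ++ s ∉ C) (w₀ : List S) (hw : w₀ ∈ C) (hne : w₀ ≠ [])
    (hR1 : ∀ u v, R u v → u ≠ [] ∧ v ≠ []) (hZ1 : ∀ z, Z z → z ≠ []) :
    ∃ (G : Type) (_ : Group G) (_ : Finite G) (x : Fin 5 → Fin 5 → S → G),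
      RelComm x ∧ RelMid x ∧
      (∀ u v, R u v → ∀ i j, i ≠ j → gVal x i j u = gVal x i j v) ∧
      (∀ z, Z z → ∀ i j, i ≠ j → gVal x i j z = 1) ∧
      gVal x 0 4 w₀ ≠ 1 := by
  classical
  have := invMod_finite R Z K
  have : Finite (Module.End (ZMod 2) (invMod R Z K)) := DFunLike.finite _
  have : Finite (Matrix (Fin 5) (Fin 5) (Module.End (ZMod 2) (invMod R Z K))) :=
    inferInstanceAs (Finite (Fin 5 → Fin 5 → Module.End (ZMod 2) (invMod R Z K)))
  refine ⟨(Matrix (Fin 5) (Fin 5) (Module.End (ZMod 2) (invMod R Z K)))ˣ, inferInstance,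
    inferInstance, fun i j c => elU i j (transOp R Z K c), ?_, ?_, ?_, ?_, ?_⟩
  · intro i j k l c d hij hkl hjk hil
    exact elU_comm _ _ hij hkl hjk hil
  · intro i j p q c d hij hpi hpj hqi hqj
    simp only [elU_mul _ _ hij hpi hpj, elU_mul _ _ hij hqi hqj]
  · intro u v h i j hij
    rw [gVal_elU _ u (hR1 u v h).1 i j hij, gVal_elU _ v (hR1 u v h).2 i j hij]
    congr 1
    ext f w
    rw [transOp_prod, transOp_prod]
    simpa using f.2.2.1 w [] u v h
  · intro z h i j hij
    rw [gVal_elU _ z (hZ1 z h) i j hij]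
    have : (z.map (transOp R Z K)).prod = 0 := by
      ext f w
      rw [transOp_prod]
      simpa using f.2.2.2 w [] z h
    rw [this, elU_zero hij]
  · rw [gVal_elU _ w₀ hne 0 4 (by decide)]
    apply elU_ne_one (by decide)
    intro h0
    let f : invMod R Z K := ⟨fun w => if w ∈ C then 1 else 0, by
      refine ⟨fun w hw => ?_, fun p s u v h => ?_, fun p s z h => ?_⟩
      · exact if_neg (fun hc => by have := hK w hc; omega)
      · simp only [hR p s u v h]
      · exact if_neg (hZ p s z h)⟩
    have h1 := transOp_prod R Z K w₀ f []
    rw [h0] at h1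
    simp [f, hw] at h1

end ModelPart

/-! ### Part 3: Turing machines as length-nondecreasing rewriting systems -/

section TMPart

set_option linter.unusedSectionVars false

open Turing

/-- Letters: machine states, tape symbols and the two end markers. -/
inductive TSym (Γ Λ : Type) : Type
  | st (q : Λ) : TSym Γ Λ
  | sy (g : Γ) : TSym Γ Λ
  | hL : TSym Γ Λ
  | hR : TSym Γ Λ

instance tsymFinite (Γ Λ : Type) [Finite Γ] [Finite Λ] : Finite (TSym Γ Λ) := by
  let f : Λ ⊕ (Γ ⊕ Bool) → TSym Γ Λ := fun z => match z with
    | .inl q => .st q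
    | .inr (.inl g) => .sy g
    | .inr (.inr true) => .hL
    | .inr (.inr false) => .hR
  refine Finite.of_surjective f ?_
  intro s
  cases s with
  | st q => exact ⟨.inl q, rfl⟩
  | sy g => exact ⟨.inr (.inl g), rfl⟩
  | hL => exact ⟨.inr (.inr true), rfl⟩
  | hR => exact ⟨.inr (.inr false), rfl⟩

variable {Γ Λ : Type} [Inhabited Γ] [Inhabited Λ]

open TSym

/-- Rewriting rules of a machine. -/
inductive Rule (M : TM0.Machine Γ Λ) : List (TSym Γ Λ) → List (TSym Γ Λ) → Prop
  | wr {q x q' y} : M q x = some (q', .write y) → Rule M [st q, sy x] [st q', sy y]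
  | mr {q x q'} : M q x = some (q', .move .right) → Rule M [st q, sy x] [sy x, st q']
  | ml {q x q'} (y) : M q x = some (q', .move .left) →
      Rule M [sy y, st q, sy x] [st q', sy y, sy x]
  | me {q x q'} : M q x = some (q', .move .left) →
      Rule M [hL, st q, sy x] [hL, st q', sy default, sy x]
  | ex (q) : Rule M [st q, hR] [st q, sy default, hR]

/-- Words equated to zero: accepting halting situations. -/
inductive ZeroWord (M : TM0.Machine Γ Λ) (acc : Γ → Prop) : List (TSym Γ Λ) → Prop
  | mk {q x} : M q x = none → acc x → ZeroWord M acc [st q, sy x]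

/-- Encoding of the left half tape. -/
def lword : List Γ → List (TSym Γ Λ)
  | [] => [hL]
  | x :: l => lword l ++ [sy x]

/-- Encoding of the right half tape. -/
def rword : List Γ → List (TSym Γ Λ)
  | [] => [hR]
  | x :: l => sy x :: rword l

/-- Encoding of a configuration. -/
def encCfg (c : List Γ × Λ × List Γ) : List (TSym Γ Λ) :=
  lword c.1 ++ st c.2.1 :: rword c.2.2

/-- One step on list configurations. -/
inductive LStep (M : TM0.Machine Γ Λ) : (List Γ × Λ × List Γ) → (List Γ × Λ × List Γ) → Prop
  | ex (l q) : LStep M (l, q, []) (l, q, [default])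
  | wr {q x q' y} (l r) : M q x = some (q', .write y) → LStep M (l, q, x :: r) (l, q', y :: r)
  | mr {q x q'} (l r) : M q x = some (q', .move .right) → LStep M (l, q, x :: r) (x :: l, q', r)
  | ml {q x q'} (y l r) : M q x = some (q', .move .left) →
      LStep M (y :: l, q, x :: r) (l, q', y :: x :: r)
  | me {q x q'} (r) : M q x = some (q', .move .left) →
      LStep M ([], q, x :: r) ([], q', default :: x :: r)

theorem lword_no_st (l : List Γ) (q : Λ) : st q ∉ lword (Λ := Λ) l := by
  induction l with
  | nil => simp [lword]
  | cons x l ih => simp [lword, ih]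

theorem rword_no_st (l : List Γ) (q : Λ) : st q ∉ rword (Λ := Λ) l := by
  induction l with
  | nil => simp [rword]
  | cons x l ih => simp [rword, ih]

theorem split_unique (A B A' B' : List (TSym Γ Λ)) (q q' : Λ)
    (h : A ++ st q :: B = A' ++ st q' :: B') (hA' : ∀ p, st p ∉ A') (hB' : ∀ p, st p ∉ B') :
    A = A' ∧ q = q' ∧ B = B' := by
  induction A generalizing A' with
  | nil =>
    cases A' with
    | nil => simpa using h
    | cons a A' =>
      simp only [List.nil_append, List.cons_append, List.cons.injEq] at h
      exact absurd (by simp [h.1]) (hA' q)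
  | cons a A ih =>
    cases A' with
    | nil =>
      simp only [List.nil_append, List.cons_append, List.cons.injEq] at h
      exact absurd (by simp [← h.2]) (hB' q)
    | cons b A' =>
      simp only [List.cons_append, List.cons.injEq] at h
      obtain ⟨h1, h2, h3⟩ := ih A' h.2 (fun p hp => hA' p (by simp [hp]))
      exact ⟨by rw [h.1, h1], h2, h3⟩

theorem enc_split {A B : List (TSym Γ Λ)} {q : Λ} {c : List Γ × Λ × List Γ}
    (h : A ++ st q :: B = encCfg c) : A = lword c.1 ∧ q = c.2.1 ∧ B = rword c.2.2 :=
  split_unique _ _ _ _ _ _ h (lword_no_st _) (rword_no_st _)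

theorem rword_sy {x : Γ} {s : List (TSym Γ Λ)} {r : List Γ} (h : sy x :: s = rword r) :
    ∃ r', r = x :: r' ∧ s = rword r' := by
  cases r with
  | nil => simp [rword] at h
  | cons y r' =>
    simp only [rword, List.cons.injEq, sy.injEq] at h
    exact ⟨r', by rw [h.1], h.2⟩

theorem rword_hR {s : List (TSym Γ Λ)} {r : List Γ} (h : hR :: s = rword r) :
    r = [] ∧ s = [] := by
  cases r with
  | nil => simpa [rword] using h
  | cons y r' => simp [rword] at h

theorem lword_sy {x : Γ} {s : List (TSym Γ Λ)} {r : List Γ} (h : s ++ [sy x] = lword r) :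
    ∃ r', r = x :: r' ∧ s = lword r' := by
  cases r with
  | nil =>
    have := congrArg List.getLast? h
    simp [lword] at this
  | cons y r' =>
    have := List.append_inj' h rfl
    simp only [List.cons.injEq, sy.injEq, and_true] at this
    exact ⟨r', by rw [this.2], this.1⟩

theorem lword_hL {s : List (TSym Γ Λ)} {r : List Γ} (h : s ++ [hL] = lword r) :
    r = [] ∧ s = [] := by
  cases r with
  | nil =>
    have := List.append_inj' (s₂ := []) h rfl
    exact ⟨rfl, this.1⟩
  | cons y r' =>
    have := congrArg List.getLast? h
    simp [lword] at this

variable {M : TM0.Machine Γ Λ}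

theorem LStep.enc {c c'} (h : LStep M c c') :
    ∃ p u v s, Rule M u v ∧ encCfg c = p ++ u ++ s ∧ encCfg c' = p ++ v ++ s := by
  cases h with
  | ex l q => exact ⟨lword l, _, _, [], .ex q, by simp [encCfg, rword], by simp [encCfg, rword]⟩
  | wr l r h =>
    exact ⟨lword l, _, _, rword r, .wr h, by simp [encCfg, rword], by simp [encCfg, rword]⟩
  | mr l r h =>
    exact ⟨lword l, _, _, rword r, .mr h, by simp [encCfg, rword], by simp [encCfg, lword]⟩
  | ml y l r h =>
    exact ⟨lword l, _, _, rword r, .ml y h, by simp [encCfg, rword, lword],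
      by simp [encCfg, rword]⟩
  | me r h =>
    exact ⟨[], _, _, rword r, .me h, by simp [encCfg, rword, lword],
      by simp [encCfg, rword, lword]⟩

theorem Rule.fwd {u v p s} {c : List Γ × Λ × List Γ} (h : Rule M u v)
    (hc : p ++ u ++ s = encCfg c) : ∃ c', LStep M c c' ∧ p ++ v ++ s = encCfg c' := by
  obtain ⟨l, q₀, r⟩ := c
  cases h with
  | @wr q x q' y h =>
    obtain ⟨h1, h2, h3⟩ := enc_split (A := p) (B := sy x :: s) (q := q) (by simpa using hc)
    dsimp only at h1 h2 h3
    obtain ⟨r', rfl, rfl⟩ := rword_sy h3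
    subst h1 h2
    exact ⟨_, .wr _ _ h, by simp [encCfg, rword]⟩
  | @mr q x q' h =>
    obtain ⟨h1, h2, h3⟩ := enc_split (A := p) (B := sy x :: s) (q := q) (by simpa using hc)
    dsimp only at h1 h2 h3
    obtain ⟨r', rfl, rfl⟩ := rword_sy h3
    subst h1 h2
    exact ⟨_, .mr _ _ h, by simp [encCfg, lword]⟩
  | @ml q x q' y h =>
    obtain ⟨h1, h2, h3⟩ := enc_split (A := p ++ [sy y]) (B := sy x :: s) (q := q)
      (by simpa using hc)
    dsimp only at h1 h2 h3
    obtain ⟨r', rfl, rfl⟩ := rword_sy h3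
    obtain ⟨l', rfl, rfl⟩ := lword_sy h1
    subst h2
    exact ⟨_, .ml _ _ _ h, by simp [encCfg, rword]⟩
  | @me q x q' h =>
    obtain ⟨h1, h2, h3⟩ := enc_split (A := p ++ [hL]) (B := sy x :: s) (q := q)
      (by simpa using hc)
    dsimp only at h1 h2 h3
    obtain ⟨r', rfl, rfl⟩ := rword_sy h3
    obtain ⟨rfl, rfl⟩ := lword_hL h1
    subst h2
    exact ⟨_, .me _ h, by simp [encCfg, rword, lword]⟩
  | ex q =>
    obtain ⟨h1, h2, h3⟩ := enc_split (A := p) (B := hR :: s) (q := q) (by simpa using hc)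
    dsimp only at h1 h2 h3
    obtain ⟨rfl, rfl⟩ := rword_hR h3
    subst h1 h2
    exact ⟨_, .ex _ _, by simp [encCfg, rword]⟩

theorem Rule.bwd {u v p s} {c' : List Γ × Λ × List Γ} (h : Rule M u v)
    (hc : p ++ v ++ s = encCfg c') : ∃ c, LStep M c c' ∧ p ++ u ++ s = encCfg c := by
  obtain ⟨l, q₀, r⟩ := c'
  cases h with
  | @wr q x q' y h =>
    obtain ⟨h1, h2, h3⟩ := enc_split (A := p) (B := sy y :: s) (q := q') (by simpa using hc)
    dsimp only at h1 h2 h3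
    obtain ⟨r', rfl, rfl⟩ := rword_sy h3
    subst h1 h2
    exact ⟨_, .wr _ _ h, by simp [encCfg, rword]⟩
  | @mr q x q' h =>
    obtain ⟨h1, h2, h3⟩ := enc_split (A := p ++ [sy x]) (B := s) (q := q') (by simpa using hc)
    dsimp only at h1 h2 h3
    obtain ⟨l', rfl, rfl⟩ := lword_sy h1
    subst h2 h3
    exact ⟨_, .mr _ _ h, by simp [encCfg, rword]⟩
  | @ml q x q' y h =>
    obtain ⟨h1, h2, h3⟩ := enc_split (A := p) (B := sy y :: sy x :: s) (q := q')
      (by simpa using hc)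
    dsimp only at h1 h2 h3
    obtain ⟨r', rfl, h4⟩ := rword_sy h3
    obtain ⟨r', rfl, rfl⟩ := rword_sy h4
    subst h1 h2
    exact ⟨_, .ml _ _ _ h, by simp [encCfg, lword, rword]⟩
  | @me q x q' h =>
    obtain ⟨h1, h2, h3⟩ := enc_split (A := p ++ [hL]) (B := sy default :: sy x :: s) (q := q')
      (by simpa using hc)
    dsimp only at h1 h2 h3
    obtain ⟨r', rfl, h4⟩ := rword_sy h3
    obtain ⟨r', rfl, rfl⟩ := rword_sy h4
    obtain ⟨rfl, rfl⟩ := lword_hL h1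
    subst h2
    exact ⟨_, .me _ h, by simp [encCfg, rword, lword]⟩
  | ex q =>
    obtain ⟨h1, h2, h3⟩ := enc_split (A := p) (B := sy default :: hR :: s) (q := q)
      (by simpa using hc)
    dsimp only at h1 h2 h3
    obtain ⟨r', rfl, h4⟩ := rword_sy h3
    obtain ⟨rfl, rfl⟩ := rword_hR h4
    subst h1 h2
    exact ⟨_, .ex _ _, by simp [encCfg, rword]⟩

theorem LStep.det {a b c} (h1 : LStep M a b) (h2 : LStep M a c) : b = c := by
  cases h1 <;> cases h2 <;> simp_all

theorem LStep.length_le {a b} (h1 : LStep M a b) :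
    (encCfg a).length ≤ (encCfg b).length := by
  cases h1 <;> simp [encCfg, lword, rword]

/-- Halted configurations. -/
def LHalt (M : TM0.Machine Γ Λ) (P : Γ → Prop) (d : List Γ × Λ × List Γ) : Prop :=
  ∃ x r, d.2.2 = x :: r ∧ M d.2.1 x = none ∧ P x

theorem LHalt.not_step {P d c} (h : LHalt M P d) : ¬ LStep M d c := by
  obtain ⟨x, r, h1, h2, -⟩ := h
  intro hs
  cases hs <;> simp_all

theorem tm_accept {G : Type} [Group G] {x : Fin 5 → Fin 5 → TSym Γ Λ → G}
    (h1 : RelComm x) (h2 : RelMid x) {acc : Γ → Prop}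
    (hR : ∀ u v, Rule M u v → ∀ i j, i ≠ j → gVal x i j u = gVal x i j v)
    (hZ : ∀ z, ZeroWord M acc z → ∀ i j, i ≠ j → gVal x i j z = 1)
    {c d} (hcd : Relation.ReflTransGen (LStep M) c d) (hd : LHalt M acc d) :
    ∀ i j, i ≠ j → gVal x i j (encCfg c) = 1 := by
  induction hcd using Relation.ReflTransGen.head_induction_on with
  | refl =>
    obtain ⟨l, q, r₀⟩ := d
    obtain ⟨y, r, h3, h4, h5⟩ := hd
    dsimp only at h3 h4
    subst h3
    intro i j hij
    have := gVal_zero_context h1 h2 [st q, sy y] (by simp) (hZ _ (.mk h4 h5)) (lword l)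
      (rword r) i j hij
    simpa [encCfg, rword] using this
  | head hs _ ih =>
    obtain ⟨p, u, v, s, hr, e1, e2⟩ := hs.enc
    intro i j hij
    rw [e1]
    rw [gVal_context h1 h2 u v ?_ ?_ (hR u v hr) p s i j hij, ← e2]
    · exact ih i j hij
    · cases hr <;> simp
    · cases hr <;> simp

theorem tm_reject [Finite Γ] [Finite Λ] {acc : Γ → Prop} {c d}
    (hcd : Relation.ReflTransGen (LStep M) c d) (hd : LHalt M (fun x => ¬ acc x) d) :
    ∃ (G : Type) (_ : Group G) (_ : Finite G) (x : Fin 5 → Fin 5 → TSym Γ Λ → G),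
      RelComm x ∧ RelMid x ∧
      (∀ u v, Rule M u v → ∀ i j, i ≠ j → gVal x i j u = gVal x i j v) ∧
      (∀ z, ZeroWord M acc z → ∀ i j, i ≠ j → gVal x i j z = 1) ∧
      gVal x 0 4 (encCfg c) ≠ 1 := by
  refine exists_model (Rule M) (ZeroWord M acc)
    {w | ∃ c, w = encCfg c ∧ Relation.ReflTransGen (LStep M) c d}
    (encCfg d).length ?_ ?_ ?_ (encCfg c) ⟨c, rfl, hcd⟩ (by simp [encCfg]) ?_ ?_
  · rintro w ⟨c, rfl, h⟩
    induction h using Relation.ReflTransGen.head_induction_on with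
    | refl => exact le_rfl
    | head hs _ ih => exact hs.length_le.trans ih
  · intro p s u v hr
    constructor
    · rintro ⟨c, e, h⟩
      obtain ⟨c', h1, h2⟩ := hr.fwd e
      refine ⟨c', h2, ?_⟩
      rcases Relation.ReflTransGen.cases_head h with rfl | ⟨c'', h3, h4⟩
      · exact absurd h1 hd.not_step
      · rw [h1.det h3]; exact h4
    · rintro ⟨c', e, h⟩
      obtain ⟨c, h1, h2⟩ := hr.bwd e
      exact ⟨c, h2, .head h1 h⟩
  · rintro p s z hz ⟨c, e, h⟩
    obtain ⟨h1, h2⟩ := hz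
    rename_i q x
    obtain ⟨h3, h4, h5⟩ := enc_split (A := p) (B := sy x :: s) (q := q) (by simpa using e)
    obtain ⟨r', h6, rfl⟩ := rword_sy h5
    have hc : LHalt M acc c := ⟨x, r', h6, by rw [← h4]; exact h1, h2⟩
    rcases Relation.ReflTransGen.cases_head h with rfl | ⟨c'', h7, -⟩
    · obtain ⟨y, r, h8, h9, h10⟩ := hd
      rw [h6] at h8
      cases h8
      exact h10 h2
    · exact hc.not_step h7
  · intro u v hr
    cases hr <;> simp
  · intro z hz
    cases hz; simp

/-- The Turing machine configuration represented by a list configuration. -/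
def repCfg (c : List Γ × Λ × List Γ) : TM0.Cfg Γ Λ :=
  ⟨c.2.1, Tape.mk' (ListBlank.mk c.1) (ListBlank.mk c.2.2)⟩

theorem simulate_step (c : List Γ × Λ × List Γ) (D) (h : D ∈ TM0.step M (repCfg c)) :
    ∃ d, Relation.ReflTransGen (LStep M) c d ∧ repCfg d = D := by
  have key : ∀ l q x r, D ∈ TM0.step M (repCfg (l, q, x :: r)) →
      ∃ d, LStep M (l, q, x :: r) d ∧ repCfg d = D := by
    intro l q x r h
    simp only [TM0.step, repCfg, Tape.mk'_head, ListBlank.head_mk, List.headI_cons,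
      Option.mem_def, Option.map_eq_some_iff] at h
    obtain ⟨⟨q', a⟩, h1, rfl⟩ := h
    cases a with
    | move dir =>
      cases dir with
      | left =>
        cases l with
        | nil =>
          refine ⟨_, .me r h1, ?_⟩
          simp [repCfg, Tape.move_left_mk']
        | cons y l =>
          refine ⟨_, .ml y l r h1, ?_⟩
          simp [repCfg, Tape.move_left_mk']
      | right =>
        refine ⟨_, .mr l r h1, ?_⟩
        simp [repCfg, Tape.move_right_mk']
    | write y =>
      refine ⟨_, .wr l r h1, ?_⟩
      simp [repCfg, Tape.write_mk']
  obtain ⟨l, q, r⟩ := c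
  cases r with
  | cons x r =>
    obtain ⟨d, h1, h2⟩ := key l q x r h
    exact ⟨d, .single h1, h2⟩
  | nil =>
    have e : repCfg (l, q, []) = repCfg (l, q, [(default : Γ)]) := by
      simp only [repCfg]
      congr 2
      exact Quotient.sound' (Or.inl ⟨1, rfl⟩)
    rw [e] at h
    obtain ⟨d, h1, h2⟩ := key l q _ [] h
    exact ⟨d, .head (.ex l q) (.single h1), h2⟩

theorem simulate (c : List Γ × Λ × List Γ) (D)
    (h : Relation.ReflTransGen (fun a b => b ∈ TM0.step M a) (repCfg c) D)
    (hD : TM0.step M D = none) (P : Γ → Prop) (hP : P D.Tape.head) :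
    ∃ d, Relation.ReflTransGen (LStep M) c d ∧ LHalt M P d := by
  have : ∃ d, Relation.ReflTransGen (LStep M) c d ∧ repCfg d = D := by
    clear hP hD
    induction h with
    | refl => exact ⟨c, .refl, rfl⟩
    | tail _ hs ih =>
      obtain ⟨d, h1, rfl⟩ := ih
      obtain ⟨d', h2, h3⟩ := simulate_step d _ hs
      exact ⟨d', h1.trans h2, h3⟩
  obtain ⟨⟨l, q, r⟩, h1, rfl⟩ := this
  cases r with
  | cons x r =>
    refine ⟨_, h1, x, r, rfl, ?_, ?_⟩
    · simpa [repCfg, TM0.step] using hD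
    · simpa [repCfg] using hP
  | nil =>
    refine ⟨_, h1.tail (.ex l q), default, [], rfl, ?_, ?_⟩
    · simpa [repCfg, TM0.step] using hD
    · simpa [repCfg] using hP

end TMPart

/-! ### Part 4: a finite Turing machine for a partial recursive function -/

section MachinePart

open Turing

theorem tm0_restrict {Γ Λ : Type} [Inhabited Γ] [Inhabited Λ] (M : TM0.Machine Γ Λ)
    (S : Finset Λ) (ss : TM0.Supports M (↑S : Set Λ)) :
    ∃ (Λ₀ : Type) (_ : Inhabited Λ₀) (_ : Finite Λ₀) (M₀ : TM0.Machine Γ Λ₀),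
      ∀ l D, TM0.Reaches M (TM0.init l) D → TM0.step M D = none →
        ∃ D₀, TM0.Reaches M₀ (TM0.init l) D₀ ∧ TM0.step M₀ D₀ = none ∧ D₀.Tape = D.Tape := by
  classical
  have hss : ∀ q a q' s, M q a = some (q', s) → q ∈ S → q' ∈ S :=
    fun q a q' s h hq => ss.2 h hq
  have hdef : (default : Λ) ∈ S := ss.1
  let i₀ : Inhabited {q // q ∈ S} := ⟨⟨default, hdef⟩⟩
  let M₀ : TM0.Machine Γ {q // q ∈ S} := fun q a =>
    match h : M q.1 a with
    | none => none
    | some (q', s) => some (⟨q', hss _ _ _ _ h q.2⟩, s)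
  have hM0 : ∀ q a, M q.1 a = none → M₀ q a = none := by
    intro q a h
    simp only [M₀]
    split
    · rfl
    · rename_i h'; rw [h] at h'; cases h'
  have hM1 : ∀ q a q' s, M q.1 a = some (q', s) → ∃ hq' : q' ∈ S, M₀ q a = some (⟨q', hq'⟩, s) := by
    intro q a q' s h
    refine ⟨hss _ _ _ _ h q.2, ?_⟩
    simp only [M₀]
    split
    · rename_i h'; rw [h] at h'; cases h'
    · rename_i h'; rw [h] at h'; cases h'; rfl
  refine ⟨{q // q ∈ S}, i₀, inferInstance, M₀, ?_⟩
  intro l D hD hh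
  have : ∃ D₀ : TM0.Cfg Γ {q // q ∈ S}, TM0.Reaches M₀ (TM0.init l) D₀ ∧
      D₀.q.1 = D.q ∧ D₀.Tape = D.Tape := by
    clear hh
    induction hD with
    | refl => exact ⟨TM0.init l, .refl, rfl, rfl⟩
    | @tail b c' _ hs ih =>
      obtain ⟨⟨q₀, T₀⟩, h1, h2, h3⟩ := ih
      obtain ⟨q, T⟩ := b
      dsimp only at h2 h3
      subst h2 h3
      simp only [TM0.step, Option.mem_def, Option.map_eq_some_iff] at hs
      obtain ⟨⟨q', a⟩, h4, rfl⟩ := hs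
      obtain ⟨hq', h5⟩ := hM1 _ _ _ _ h4
      cases a with
      | move d =>
        refine ⟨⟨⟨q', hq'⟩, T₀.move d⟩, Relation.ReflTransGen.tail h1 ?_, rfl, rfl⟩
        simp only [TM0.step, h5, Option.map_some, Option.mem_def]
      | write y =>
        refine ⟨⟨⟨q', hq'⟩, T₀.write y⟩, Relation.ReflTransGen.tail h1 ?_, rfl, rfl⟩
        simp only [TM0.step, h5, Option.map_some, Option.mem_def]
  obtain ⟨⟨q₀, T₀⟩, h1, h2, h3⟩ := this
  obtain ⟨q, T⟩ := D
  dsimp only at h2 h3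
  subst h2 h3
  refine ⟨_, h1, ?_, rfl⟩
  simp only [TM0.step, Option.map_eq_none_iff] at hh ⊢
  exact hM0 _ _ hh

theorem tm2_to_tm0 {K : Type} [DecidableEq K] {Γ : K → Type}
    {Λ σ : Type} [Inhabited Λ] [Inhabited σ] [Fintype σ]
    (M : Λ → TM2.Stmt Γ Λ σ) (S : Finset Λ) (ss : TM2.Supports M S) (k : K) :
    ∃ (Λ₀ : Type) (_ : Inhabited Λ₀) (_ : Finite Λ₀) (M₀ : TM0.Machine (TM2to1.Γ' K Γ) Λ₀),
      ∀ L L₂, L₂ ∈ TM2.eval M k L →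
        ∃ D, TM0.Reaches M₀ (TM0.init (TM2to1.trInit k L)) D ∧ TM0.step M₀ D = none ∧
          ((D.Tape.head.2 k).isSome = true ↔ L₂ ≠ []) := by
  have s1 := TM2to1.tr_supports M ss
  have s2 := TM1to0.tr_supports _ s1
  obtain ⟨Λ₀, i1, i2, M₀, hM⟩ := tm0_restrict _ _ s2
  refine ⟨Λ₀, i1, i2, M₀, fun L L₂ hL => ?_⟩
  have hd : (TM1.eval (TM2to1.tr M) (TM2to1.trInit k L)).Dom :=
    (TM2to1.tr_eval_dom M k L).2 (Part.dom_iff_mem.2 ⟨_, hL⟩)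
  obtain ⟨L₁, hL₁⟩ := Part.dom_iff_mem.1 hd
  obtain ⟨St, L', h1, h2, h3⟩ := TM2to1.tr_eval M k L hL₁ hL
  rw [← TM1to0.tr_eval, TM0.eval, Part.mem_map_iff] at hL₁
  obtain ⟨D, hD, hD'⟩ := hL₁
  rw [StateTransition.mem_eval] at hD
  obtain ⟨D₀, h4, h5, h6⟩ := hM _ D hD.1 hD.2
  refine ⟨D₀, h4, h5, ?_⟩
  have h7 : D.Tape.head = L₁.head := by
    rw [← hD', Tape.right₀, ListBlank.head_cons]
  rw [h6, h7, ← h1, ← h3]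
  have h8 := congrArg ListBlank.head (h2 k)
  rw [ListBlank.head_map, ListBlank.head_mk] at h8
  have h9 : (TM2to1.addBottom L').head.2 k = L'.head k :=
    congrFun (congrArg Prod.snd (ListBlank.head_cons _ _)) k
  have h10 : L'.head k = ((St k).map some).reverse.headI := h8
  rw [h9, h10, ← List.map_reverse]
  rcases List.eq_nil_or_concat (St k) with h | ⟨l, a, h⟩
  · rw [h]; simp; rfl
  · rw [h]; simp

theorem trPosNum_pow (m : ℕ) : PartrecToTM2.trNat (2 ^ m) =
    List.replicate m PartrecToTM2.Γ'.bit0 ++ [PartrecToTM2.Γ'.bit1] := by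
  have h : ∀ m, ∃ p : PosNum, ((2 ^ m : ℕ) : Num) = Num.pos p ∧ PartrecToTM2.trPosNum p =
      List.replicate m PartrecToTM2.Γ'.bit0 ++ [PartrecToTM2.Γ'.bit1] := by
    intro m
    induction m with
    | zero => exact ⟨.one, by simp; rfl, rfl⟩
    | succ m ih =>
      obtain ⟨p, h1, h2⟩ := ih
      refine ⟨.bit0 p, ?_, ?_⟩
      · rw [pow_succ, mul_comm, two_mul, Nat.cast_add, h1]
        exact Num.bit0_of_bit0 (Num.pos p)
      · simp [PartrecToTM2.trPosNum, h2, List.replicate_succ]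
  obtain ⟨p, h1, h2⟩ := h m
  rw [PartrecToTM2.trNat, h1]
  exact h2

theorem exists_tm (c : ToPartrec.Code) :
    ∃ (Γ Λ : Type) (_ : Inhabited Γ) (_ : Inhabited Λ) (_ : Finite Γ) (_ : Finite Λ)
      (M : TM0.Machine Γ Λ) (acc : Γ → Prop) (a b t : Γ), ∀ n o, o ∈ c.eval [4 ^ n] →
        ∃ D, TM0.Reaches M (TM0.init (a :: b :: List.replicate (2 * n) t)) D ∧
          TM0.step M D = none ∧ (acc D.Tape.head ↔ o ≠ []) := by
  have ss := PartrecToTM2.tr_supports c .halt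
  let i0 : Inhabited PartrecToTM2.Λ' := ⟨PartrecToTM2.trNormal c .halt⟩
  obtain ⟨Λ₀, i1, i2, M₀, hM⟩ := @tm2_to_tm0 _ _ _ _ _ i0 _ _ _ _ ss PartrecToTM2.K'.main
  let t : PartrecToTM2.Γ' → TM2to1.Γ' PartrecToTM2.K' (fun _ => PartrecToTM2.Γ') := fun a =>
    (false, Function.update (fun _ => none) PartrecToTM2.K'.main (some a))
  have fK : Finite PartrecToTM2.K' := by
    refine Finite.of_surjective (fun n : Fin 4 => match n with
      | 0 => PartrecToTM2.K'.main | 1 => .rev | 2 => .aux | 3 => .stack) ?_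
    intro k
    cases k
    · exact ⟨0, rfl⟩
    · exact ⟨1, rfl⟩
    · exact ⟨2, rfl⟩
    · exact ⟨3, rfl⟩
  have fG : Finite (TM2to1.Γ' PartrecToTM2.K' (fun _ => PartrecToTM2.Γ')) :=
    inferInstanceAs (Finite (Bool × (PartrecToTM2.K' → Option PartrecToTM2.Γ')))
  refine ⟨_, Λ₀, inferInstance, i1, fG, i2, M₀,
    fun x => (x.2 PartrecToTM2.K'.main).isSome = true,
    (true, (t .cons).2), t .bit1, t .bit0, fun n o ho => ?_⟩
  have h1 : PartrecToTM2.trList o ∈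
      @TM2.eval _ _ _ _ i0 _ _ PartrecToTM2.tr PartrecToTM2.K'.main
        (PartrecToTM2.trList [4 ^ n]) := by
    have h2 := PartrecToTM2.tr_eval c [4 ^ n]
    refine (Part.mem_map_iff _).2 ⟨PartrecToTM2.halt o, ?_, rfl⟩
    have h3 : PartrecToTM2.halt o ∈ PartrecToTM2.halt <$> c.eval [4 ^ n] :=
      Part.mem_map _ ho
    rw [← h2] at h3
    have hst : (Function.update (fun _ => []) PartrecToTM2.K'.main
        (PartrecToTM2.trList [4 ^ n]) : PartrecToTM2.K' → List PartrecToTM2.Γ') =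
        PartrecToTM2.K'.elim (PartrecToTM2.trList [4 ^ n]) [] [] [] := by
      funext k
      cases k <;> simp [PartrecToTM2.K'.elim]
    have h4 : (⟨some (PartrecToTM2.trNormal c .halt), none,
        Function.update (fun _ => []) PartrecToTM2.K'.main (PartrecToTM2.trList [4 ^ n])⟩ :
        PartrecToTM2.Cfg') = PartrecToTM2.init c [4 ^ n] :=
      congrArg (TM2.Cfg.mk (some (PartrecToTM2.trNormal c .halt)) none) hst
    rw [← h4] at h3
    exact h3
  obtain ⟨D, h2, h3, h4⟩ := hM _ _ h1
  refine ⟨D, ?_, h3, h4.trans ?_⟩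
  · convert h2 using 2
    rw [PartrecToTM2.trList, show (4 : ℕ) ^ n = 2 ^ (2 * n) by rw [pow_mul]; norm_num,
      trPosNum_pow]
    simp [TM2to1.trInit, PartrecToTM2.trList, t]
    exact congrArg₂ List.cons rfl (congrArg₂ List.cons rfl
      (List.map_replicate (f := t) (a := PartrecToTM2.Γ'.bit0) (n := 2 * n)).symm)
  · cases o <;> simp [PartrecToTM2.trList]

theorem exists_sep_code : ∃ c : ToPartrec.Code, ∀ h : ℕ → Bool, Computable h →
    ∃ n o, o ∈ c.eval [4 ^ n] ∧ ¬ (h n = true ↔ o ≠ []) := by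
  let g : ℕ →. ℕ := fun n => Nat.Partrec.Code.eval (Denumerable.ofNat Nat.Partrec.Code n) n
  have hg : Partrec g :=
    Nat.Partrec.Code.eval_part.comp (Computable.ofNat _) Computable.id
  let F : ℕ →. ℕ := fun m =>
    (Nat.rfind fun n => Part.some (decide (4 ^ n = m))).bind g
  have hpow : Primrec₂ (fun a b : ℕ => a ^ b) := Primrec₂.unpaired'.1 Nat.Primrec.pow
  have hF : Partrec F := by
    refine Partrec.bind (Partrec.rfind ?_) (hg.comp Computable.snd)
    have : Primrec₂ (fun m n : ℕ => decide (4 ^ n = m)) :=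
      (Primrec.eq.comp (hpow.comp (Primrec.const 4) Primrec.snd) Primrec.fst).decide
    exact this.to_comp.partrec₂
  obtain ⟨c, hc⟩ := ToPartrec.Code.exists_code (Nat.Partrec'.part_iff₁.2 hF)
  have hF4 : ∀ n, F (4 ^ n) = g n := by
    intro n
    have : Nat.rfind (fun k => Part.some (decide (4 ^ k = 4 ^ n))) = Part.some n := by
      rw [Part.eq_some_iff]
      refine Nat.mem_rfind.2 ⟨?_, ?_⟩
      · simp
      · intro m hm
        have : (4 : ℕ) ^ m ≠ 4 ^ n := (Nat.pow_lt_pow_right (by norm_num) hm).ne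
        simp [this]
    simp only [F, this]
    exact Part.bind_some n g
  refine ⟨(ToPartrec.Code.case .zero' .nil).comp c, fun h hh => ?_⟩
  have hk : Partrec (fun n => (Part.some (if h n = true then 1 else 0) : Part ℕ)) := by
    have : Computable (fun n => if h n = true then 1 else 0) := by
      have := Computable.cond hh (Computable.const 1) (Computable.const 0)
      refine this.of_eq fun n => ?_
      cases h n <;> rfl
    exact this.partrec
  obtain ⟨e, he⟩ := Nat.Partrec.Code.exists_code.1 (Partrec.nat_iff.1 hk)
  have hgn : g (Encodable.encode e) =
      Part.some (if h (Encodable.encode e) = true then 1 else 0) := by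
    simp only [g, Denumerable.ofNat_encode, he]
  have hce : c.eval [4 ^ (Encodable.encode e)] =
      Part.some [if h (Encodable.encode e) = true then 1 else 0] := by
    have := hc ⟨[4 ^ (Encodable.encode e)], rfl⟩
    rw [this]
    change pure <$> F (4 ^ (Encodable.encode e)) = _
    rw [hF4, hgn]
    simp
  cases hb : h (Encodable.encode e) with
  | true =>
    refine ⟨Encodable.encode e, [], ?_, by simp [hb]⟩
    simp [hce, hb]
  | false =>
    refine ⟨Encodable.encode e, [0], ?_, by simp [hb]⟩
    simp [hce, hb]

end MachinePart

/-! ### Part 5: sentences and their codes -/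

section FormulaPart

open FirstOrder.Language

variable {k : ℕ}

/-- Terms in `k` variables. -/
abbrev GTerm (k : ℕ) : Type := grpLang.Term (Empty ⊕ Fin k)

/-- The identity term. -/
def tOne : GTerm k := Term.func (L := grpLang) (l := 0) () ![]

/-- The inverse term. -/
def tInv (a : GTerm k) : GTerm k := Term.func (L := grpLang) (l := 1) () ![a]

/-- The product term. -/
def tMul (a b : GTerm k) : GTerm k := Term.func (L := grpLang) (l := 2) () ![a, b]

/-- The commutator term. -/
def tComm (a b : GTerm k) : GTerm k := tMul (tMul (tMul a b) (tInv a)) (tInv b)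

section Realize

variable {G : Type} [Group G] (v : Empty ⊕ Fin k → G)

theorem realize_tOne : (tOne : GTerm k).realize v = 1 := rfl

theorem realize_tInv (a : GTerm k) : (tInv a).realize v = (a.realize v)⁻¹ := rfl

theorem realize_tMul (a b : GTerm k) : (tMul a b).realize v = a.realize v * b.realize v := rfl

theorem realize_tComm (a b : GTerm k) :
    (tComm a b).realize v = ⁅a.realize v, b.realize v⁆ := rfl

theorem realize_wordVal {S : Type} (X : Fin 5 → Fin 5 → S → GTerm k) (w : List S) :
    ∀ i j, (wordVal tComm tOne X i j w).realize v =
      gVal (fun i j c => (X i j c).realize v) i j w := by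
  induction w with
  | nil => intro i j; rfl
  | cons c w ih =>
    intro i j
    cases w with
    | nil => rfl
    | cons d w =>
      simp only [gVal, wordVal] at ih ⊢
      rw [realize_tComm, ih]

end Realize

/-- Chains of implications between equations. -/
def chainImp (L : List (GTerm k × GTerm k)) (ψ : grpLang.BoundedFormula Empty k) :
    grpLang.BoundedFormula Empty k :=
  L.foldr (fun p φ => (Term.bdEqual p.1 p.2).imp φ) ψ

theorem chainImp_isQF (L : List (GTerm k × GTerm k)) (s t : GTerm k) :
    (chainImp L (Term.bdEqual s t)).IsQF := by
  induction L with
  | nil => exact (BoundedFormula.IsAtomic.equal _ _).isQF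
  | cons p L ih => exact ((BoundedFormula.IsAtomic.equal _ _).isQF).imp ih

theorem realize_chainImp {G : Type} [Group G] (L : List (GTerm k × GTerm k)) (s t : GTerm k)
    (v : Empty → G) (xs : Fin k → G) :
    (chainImp L (Term.bdEqual s t)).Realize v xs ↔
      ((∀ p ∈ L, p.1.realize (Sum.elim v xs) = p.2.realize (Sum.elim v xs)) →
        s.realize (Sum.elim v xs) = t.realize (Sum.elim v xs)) := by
  induction L with
  | nil => simp [chainImp]
  | cons p L ih =>
    simp only [chainImp, List.foldr_cons, BoundedFormula.realize_imp,
      BoundedFormula.realize_bdEqual, List.mem_cons, forall_eq_or_imp] at ih ⊢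
    rw [ih]
    tauto

/-- The code list of a term. -/
def tCode (T : GTerm k) : List ℕ := T.listEncode.map Encodable.encode

theorem encode_list_map {α : Type*} [Encodable α] (l : List α) :
    Encodable.encode l = Encodable.encode (l.map (Encodable.encode (α := α))) := by
  induction l with
  | nil => rfl
  | cons a l ih => simp only [List.map_cons, Encodable.encode_list_cons, ih, Encodable.encode_nat]

theorem encode_term (T : GTerm k) : Encodable.encode T = Encodable.encode (tCode T) :=
  encode_list_map T.listEncode

theorem tCode_inv : ∃ c : ℕ, ∀ a : GTerm k, tCode (tInv a) = c :: tCode a := by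
  refine ⟨Encodable.encode (Sum.inr ⟨1, ()⟩ : (Empty ⊕ Fin k) ⊕ (Σ i, grpLang.Functions i)), ?_⟩
  intro a
  simp [tCode, tInv, Term.listEncode, List.finRange_succ]

theorem tCode_mul : ∃ c : ℕ, ∀ a b : GTerm k, tCode (tMul a b) = c :: (tCode a ++ tCode b) := by
  refine ⟨Encodable.encode (Sum.inr ⟨2, ()⟩ : (Empty ⊕ Fin k) ⊕ (Σ i, grpLang.Functions i)), ?_⟩
  intro a b
  simp [tCode, tMul, Term.listEncode, List.finRange_succ]

theorem tCode_comm (x : GTerm k) : ∃ F : List ℕ → List ℕ, Primrec F ∧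
    ∀ W : GTerm k, tCode (tComm x W) = F (tCode W) := by
  obtain ⟨cI, hI⟩ := tCode_inv (k := k)
  obtain ⟨cM, hM⟩ := tCode_mul (k := k)
  refine ⟨fun l => (cM :: cM :: cM :: tCode x) ++ (l ++ ((cI :: tCode x ++ [cI]) ++ l)), ?_, ?_⟩
  · exact Primrec.list_append.comp (Primrec.const _)
      (Primrec.list_append.comp Primrec.id
        (Primrec.list_append.comp (Primrec.const _) Primrec.id))
  · intro W
    simp [tComm, hI, hM]

theorem wordVal_cons {α S : Type*} (cm : α → α → α) (e : α) (x : Fin 5 → Fin 5 → S → α)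
    (i j : Fin 5) (c : S) (w : List S) (hw : w ≠ []) :
    wordVal cm e x i j (c :: w) = cm (x i (thirdIx i j) c) (wordVal cm e x (thirdIx i j) j w) := by
  cases w with
  | nil => exact absurd rfl hw
  | cons d w => rfl

theorem tCode_word {S : Type} (X : Fin 5 → Fin 5 → S → GTerm k) (p : List S) (s r : S)
    (hp : p.length = 4) :
    Primrec (fun n => tCode (wordVal tComm tOne X 0 4 (p ++ (List.replicate (2 * n) s ++ [r])))) := by
  have e04 : thirdIx 0 4 = 1 := by decide
  have e14 : thirdIx 1 4 = 0 := by decide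
  have h2 : ∀ c d : S, ∃ F : List ℕ → List ℕ, Primrec F ∧ ∀ w : List S, w ≠ [] →
      tCode (wordVal tComm tOne X 0 4 (c :: d :: w)) = F (tCode (wordVal tComm tOne X 0 4 w)) := by
    intro c d
    obtain ⟨F₁, p₁, h₁⟩ := tCode_comm (X 0 1 c)
    obtain ⟨F₂, p₂, h₂⟩ := tCode_comm (X 1 0 d)
    refine ⟨fun l => F₁ (F₂ l), p₁.comp p₂, fun w hw => ?_⟩
    rw [wordVal_cons _ _ _ _ _ _ _ (by simp), e04, wordVal_cons _ _ _ _ _ _ _ hw, e14, h₁, h₂]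
  have h3 : Primrec (fun n =>
      tCode (wordVal tComm tOne X 0 4 (List.replicate (2 * n) s ++ [r]))) := by
    obtain ⟨F, pF, hF⟩ := h2 s s
    have : Primrec (fun n : ℕ => (Nat.rec (tCode (X 0 4 r)) (fun _ l => F l) n : List ℕ)) :=
      Primrec.nat_rec₁ _ (pF.comp Primrec.snd)
    refine this.of_eq fun n => ?_
    induction n with
    | zero => rfl
    | succ n ih =>
      change F _ = _
      rw [ih, show 2 * (n + 1) = 2 * n + 1 + 1 by ring, List.replicate_succ, List.replicate_succ,
        List.cons_append, List.cons_append, hF _ (by simp)]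
  match p, hp with
  | [a, b, c, d], _ =>
    obtain ⟨F₁, p₁, h₁⟩ := h2 a b
    obtain ⟨F₂, p₂, h₂⟩ := h2 c d
    refine (p₁.comp (p₂.comp h3)).of_eq fun n => ?_
    simp only [List.cons_append, List.nil_append]
    rw [h₁ _ (by simp), h₂ _ (by simp)]

theorem listEncode_alls : ∀ k : ℕ, ∃ pre, ∀ φ : grpLang.BoundedFormula Empty k,
    BoundedFormula.listEncode φ.alls = pre ++ φ.listEncode
  | 0 => ⟨[], fun φ => rfl⟩
  | k + 1 => by
    obtain ⟨pre, h⟩ := listEncode_alls k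
    refine ⟨pre ++ [Sum.inr (Sum.inr 1)], fun φ => ?_⟩
    rw [BoundedFormula.alls, h]
    simp [BoundedFormula.listEncode]

theorem listEncode_chain (L : List (GTerm k × GTerm k)) : ∃ pre,
    ∀ φ : grpLang.BoundedFormula Empty k, (chainImp L φ).listEncode = pre ++ φ.listEncode := by
  induction L with
  | nil => exact ⟨[], fun φ => rfl⟩
  | cons p L ih =>
    obtain ⟨pre, h⟩ := ih
    refine ⟨Sum.inr (Sum.inr 0) :: ((Term.bdEqual p.1 p.2).listEncode ++ pre), fun φ => ?_⟩
    rw [chainImp, List.foldr_cons, BoundedFormula.listEncode, ← chainImp, h]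
    simp only [List.cons_append, List.append_assoc]

theorem encode_sentence_computable (L : List (GTerm k × GTerm k)) (T : ℕ → GTerm k)
    (hT : Primrec (fun n => tCode (T n))) :
    Computable (fun n =>
      Encodable.encode (chainImp L (Term.bdEqual (T n) tOne)).alls) := by
  obtain ⟨p₁, h₁⟩ := listEncode_alls k
  obtain ⟨p₂, h₂⟩ := listEncode_chain L
  have key : ∀ n, Encodable.encode (chainImp L (Term.bdEqual (T n) tOne)).alls =
      Encodable.encode (((p₁ ++ p₂).map Encodable.encode) ++
        [2 * Nat.pair k (Encodable.encode (tCode (T n))),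
         2 * Nat.pair k (Encodable.encode (tCode (tOne : GTerm k)))]) := by
    intro n
    have e1 : Encodable.encode (chainImp L (Term.bdEqual (T n) tOne)).alls =
        Encodable.encode (BoundedFormula.listEncode
          (chainImp L (Term.bdEqual (T n) tOne)).alls) := rfl
    rw [e1, encode_list_map, h₁, h₂, Term.bdEqual, BoundedFormula.listEncode]
    simp only [List.map_append, List.map_cons, List.map_nil, List.append_assoc,
      Encodable.encode_inl, Encodable.encode_sigma_val, Encodable.encode_nat, encode_term]
  have hp : Primrec (fun n => Encodable.encode (((p₁ ++ p₂).map Encodable.encode) ++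
        [2 * Nat.pair k (Encodable.encode (tCode (T n))),
         2 * Nat.pair k (Encodable.encode (tCode (tOne : GTerm k)))])) := by
    have hc : Primrec (fun n => 2 * Nat.pair k (Encodable.encode (tCode (T n)))) :=
      Primrec.nat_mul.comp (Primrec.const 2)
        (Primrec₂.natPair.comp (Primrec.const k) (Primrec.encode.comp hT))
    exact Primrec.encode.comp (Primrec.list_append.comp (Primrec.const _)
      (Primrec.list_cons.comp hc (Primrec.const _)))
  exact (hp.of_eq fun n => (key n).symm).to_comp

end FormulaPart

/-! ### Part 6: the conclusion -/

section Final

open FirstOrder.Language Turing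

/-- The group theoretic consequence expressed by the sentences. -/
def Conseq {S : Type} (R : List S → List S → Prop) (Z : List S → Prop) (w : List S)
    (G : Type) [Group G] : Prop :=
  ∀ x : Fin 5 → Fin 5 → S → G, RelComm x → RelMid x →
    (∀ u v, R u v → ∀ i j, i ≠ j → gVal x i j u = gVal x i j v) →
    (∀ z, Z z → ∀ i j, i ≠ j → gVal x i j z = 1) → gVal x 0 4 w = 1

theorem core_undecidable : ∃ (S : Type) (_ : Finite S) (R : List S → List S → Prop)
    (Z : List S → Prop) (p : List S) (s r : S), p.length = 4 ∧
    (∀ u v, R u v → u.length ≤ 4 ∧ v.length ≤ 4) ∧ (∀ z, Z z → z.length ≤ 4) ∧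
    ∀ h : ℕ → Bool, Computable h → ¬ ∀ n, (h n = true ↔ ∀ (G : Type) [Group G], Finite G →
      Conseq R Z (p ++ (List.replicate (2 * n) s ++ [r])) G) := by
  obtain ⟨c, hc⟩ := exists_sep_code
  obtain ⟨Γ, Λ, i1, i2, i3, i4, M, acc, a, b, t, hM⟩ := exists_tm c
  refine ⟨TSym Γ Λ, inferInstance, Rule M, ZeroWord M acc,
    [.hL, .st default, .sy a, .sy b], .sy t, .hR, rfl, ?_, ?_, ?_⟩
  · intro u v h
    cases h <;> simp
  · intro z h
    cases h; simp
  · intro h hh hall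
    obtain ⟨n, o, ho, hno⟩ := hc h hh
    apply hno
    rw [hall n]
    obtain ⟨D, hD1, hD2, hD3⟩ := hM n o ho
    have hstart : (TM0.init (a :: b :: List.replicate (2 * n) t) : TM0.Cfg Γ Λ) =
        repCfg ([], default, a :: b :: List.replicate (2 * n) t) := rfl
    have henc : ([.hL, .st default, .sy a, .sy b] ++
        (List.replicate (2 * n) (.sy t) ++ [.hR]) : List (TSym Γ Λ)) =
        encCfg ([], default, a :: b :: List.replicate (2 * n) t) := by
      have : ∀ m, (List.replicate m (.sy t) ++ [.hR] : List (TSym Γ Λ)) =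
          rword (List.replicate m t) := by
        intro m
        induction m with
        | zero => rfl
        | succ m ih => simp [List.replicate_succ, rword, ← ih]
      rw [this]
      rfl
    rw [hstart] at hD1
    rw [henc, ← hD3]
    constructor
    · intro hG
      by_contra hacc
      obtain ⟨d, h1, h2⟩ := simulate _ D hD1 hD2 (fun x => ¬ acc x) hacc
      obtain ⟨G, g1, g2, x, k1, k2, k3, k4, k5⟩ := tm_reject h1 h2
      exact k5 (hG G g2 x k1 k2 k3 k4)
    · intro hacc G _ _ x k1 k2 k3 k4
      obtain ⟨d, h1, h2⟩ := simulate _ D hD1 hD2 acc hacc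
      exact tm_accept k1 k2 k3 k4 h1 h2 0 4 (by decide)

/-- The set of hypotheses as pairs of terms. -/
def relSet {S : Type} {k : ℕ} (R : List S → List S → Prop) (Z : List S → Prop)
    (X : Fin 5 → Fin 5 → S → GTerm k) : Set (GTerm k × GTerm k) :=
  {q | ∃ i j k' l c d, i ≠ j ∧ k' ≠ l ∧ j ≠ k' ∧ i ≠ l ∧ q = (tComm (X i j c) (X k' l d), tOne)} ∪
  {q | ∃ i j p p' c d, i ≠ j ∧ p ≠ i ∧ p ≠ j ∧ p' ≠ i ∧ p' ≠ j ∧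
    q = (tComm (X i p c) (X p j d), tComm (X i p' c) (X p' j d))} ∪
  {q | ∃ u v i j, R u v ∧ i ≠ j ∧ q = (wordVal tComm tOne X i j u, wordVal tComm tOne X i j v)} ∪
  {q | ∃ z i j, Z z ∧ i ≠ j ∧ q = (wordVal tComm tOne X i j z, tOne)}

theorem relSet_finite {S : Type} [Finite S] {k : ℕ} (R : List S → List S → Prop)
    (Z : List S → Prop) (X : Fin 5 → Fin 5 → S → GTerm k)
    (hR : ∀ u v, R u v → u.length ≤ 4 ∧ v.length ≤ 4) (hZ : ∀ z, Z z → z.length ≤ 4) :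
    (relSet R Z X).Finite := by
  have hfin : {l : List S | l.length ≤ 4}.Finite := List.finite_length_le S 4
  have : Finite {l : List S | l.length ≤ 4} := hfin
  refine ((Set.Finite.union ?_ ?_).union ?_).union ?_
  · refine (Set.finite_range (fun t : Fin 5 × Fin 5 × Fin 5 × Fin 5 × S × S =>
      ((tComm (X t.1 t.2.1 t.2.2.2.2.1) (X t.2.2.1 t.2.2.2.1 t.2.2.2.2.2), tOne) :
        GTerm k × GTerm k))).subset ?_
    rintro q ⟨i, j, k', l, c, d, -, -, -, -, rfl⟩
    exact ⟨(i, j, k', l, c, d), rfl⟩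
  · refine (Set.finite_range (fun t : Fin 5 × Fin 5 × Fin 5 × Fin 5 × S × S =>
      ((tComm (X t.1 t.2.2.1 t.2.2.2.2.1) (X t.2.2.1 t.2.1 t.2.2.2.2.2),
        tComm (X t.1 t.2.2.2.1 t.2.2.2.2.1) (X t.2.2.2.1 t.2.1 t.2.2.2.2.2)) :
        GTerm k × GTerm k))).subset ?_
    rintro q ⟨i, j, k', l, c, d, -, -, -, -, -, rfl⟩
    exact ⟨(i, j, k', l, c, d), rfl⟩
  · refine (Set.finite_range (fun t : Fin 5 × Fin 5 × {l : List S | l.length ≤ 4} ×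
      {l : List S | l.length ≤ 4} =>
      ((wordVal tComm tOne X t.1 t.2.1 t.2.2.1.1, wordVal tComm tOne X t.1 t.2.1 t.2.2.2.1) :
        GTerm k × GTerm k))).subset ?_
    rintro q ⟨u, v, i, j, h, -, rfl⟩
    exact ⟨(i, j, ⟨u, (hR u v h).1⟩, ⟨v, (hR u v h).2⟩), rfl⟩
  · refine (Set.finite_range (fun t : Fin 5 × Fin 5 × {l : List S | l.length ≤ 4} =>
      ((wordVal tComm tOne X t.1 t.2.1 t.2.2.1, tOne) : GTerm k × GTerm k))).subset ?_
    rintro q ⟨u, i, j, h, -, rfl⟩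
    exact ⟨(i, j, ⟨u, hZ u h⟩), rfl⟩

theorem relSet_realize {S : Type} {k : ℕ} (R : List S → List S → Prop)
    (Z : List S → Prop) (X : Fin 5 → Fin 5 → S → GTerm k) {G : Type} [Group G]
    (v : Empty ⊕ Fin k → G) :
    (∀ q ∈ relSet R Z X, q.1.realize v = q.2.realize v) ↔
      RelComm (fun i j c => (X i j c).realize v) ∧ RelMid (fun i j c => (X i j c).realize v) ∧
      (∀ u w, R u w → ∀ i j, i ≠ j → gVal (fun i j c => (X i j c).realize v) i j u =
        gVal (fun i j c => (X i j c).realize v) i j w) ∧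
      (∀ z, Z z → ∀ i j, i ≠ j → gVal (fun i j c => (X i j c).realize v) i j z = 1) := by
  constructor
  · intro h
    refine ⟨?_, ?_, ?_, ?_⟩
    · intro i j k' l c d h1 h2 h3 h4
      exact h _ (Or.inl (Or.inl (Or.inl ⟨i, j, k', l, c, d, h1, h2, h3, h4, rfl⟩)))
    · intro i j p p' c d h1 h2 h3 h4 h5
      exact h _ (Or.inl (Or.inl (Or.inr ⟨i, j, p, p', c, d, h1, h2, h3, h4, h5, rfl⟩)))
    · intro u w huw i j hij
      have := h _ (Or.inl (Or.inr ⟨u, w, i, j, huw, hij, rfl⟩))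
      rwa [realize_wordVal, realize_wordVal] at this
    · intro z hz i j hij
      have := h _ (Or.inr ⟨z, i, j, hz, hij, rfl⟩)
      rwa [realize_wordVal] at this
  · rintro ⟨h1, h2, h3, h4⟩ q (((⟨i, j, k', l, c, d, a1, a2, a3, a4, rfl⟩ |
      ⟨i, j, p, p', c, d, a1, a2, a3, a4, a5, rfl⟩) | ⟨u, w, i, j, a1, a2, rfl⟩) |
      ⟨z, i, j, a1, a2, rfl⟩)
    · exact h1 i j k' l c d a1 a2 a3 a4
    · exact h2 i j p p' c d a1 a2 a3 a4 a5
    · rw [realize_wordVal, realize_wordVal]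
      exact h3 u w a1 i j a2
    · rw [realize_wordVal]
      exact h4 z a1 i j a2

theorem sentence_iff {S : Type} {k : ℕ} (e : Fin 5 × Fin 5 × S ≃ Fin k)
    (R : List S → List S → Prop) (Z : List S → Prop) (L : List (GTerm k × GTerm k))
    (hL : ∀ q, q ∈ L ↔ q ∈ relSet R Z (fun i j c => Term.var (Sum.inr (e (i, j, c)))))
    (w : List S) (G : Type) [Group G] :
    G ⊨ ((chainImp L (Term.bdEqual
      (wordVal tComm tOne (fun i j c => Term.var (Sum.inr (e (i, j, c)))) 0 4 w) tOne)).alls :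
        grpLang.Sentence) ↔ Conseq R Z w G := by
  rw [Sentence.Realize, BoundedFormula.realize_alls]
  simp only [realize_chainImp, hL, relSet_realize, realize_wordVal, realize_tOne,
    Term.realize_var, Sum.elim_inr]
  constructor
  · intro h x k1 k2 k3 k4
    have := h (fun m => x (e.symm m).1 (e.symm m).2.1 (e.symm m).2.2)
    simp only [Equiv.symm_apply_apply] at this
    exact this ⟨k1, k2, k3, k4⟩
  · rintro h xs ⟨k1, k2, k3, k4⟩
    exact h _ k1 k2 k3 k4

end Final

/-- The universal theory of the class of finite groups is undecidable: no computable
function decides, for a given universal sentence, whether it holds in every finite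
group. -/
theorem univTheory_finite_undecidable :
    ¬ ∃ f : ℕ → Bool, Computable f ∧
      ∀ φ : grpLang.Sentence, IsUniversalSentence φ →
        (f (Encodable.encode φ) = true ↔
          ∀ (G : Type) [Group G], Finite G → G ⊨ φ) := by
  rintro ⟨f, hf, hφ⟩
  obtain ⟨S, i1, R, Z, p, s, r, hp, hR, hZ, hcore⟩ := core_undecidable
  obtain ⟨k, ⟨e⟩⟩ := Finite.exists_equiv_fin (Fin 5 × Fin 5 × S)
  let X : Fin 5 → Fin 5 → S → GTerm k := fun i j c =>
    FirstOrder.Language.Term.var (Sum.inr (e (i, j, c)))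
  have hfin := relSet_finite R Z X hR hZ
  let L := hfin.toFinset.toList
  have hL : ∀ q, q ∈ L ↔ q ∈ relSet R Z X := by
    intro q
    simp [L]
  let T : ℕ → GTerm k := fun n =>
    wordVal tComm tOne X 0 4 (p ++ (List.replicate (2 * n) s ++ [r]))
  have hT : Primrec (fun n => tCode (T n)) := tCode_word X p s r hp
  refine hcore _ (hf.comp (encode_sentence_computable L T hT)) fun n => ?_
  rw [hφ _ ⟨k, _, chainImp_isQF L (T n) tOne, rfl⟩]
  exact forall_congr' fun G => forall_congr' fun _ => forall_congr' fun _ =>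
    sentence_iff e R Z L hL _ G
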